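/- Suppose the characteristic of F is neither 2 nor 3, and let D = D_F(D_4) with Jacobson radical J(D). Then J(D), viewed as an F-subspace of F[W(D_4)], equals the F-span of the five elements x_{{0}}−x_{{1}}, x_{{1}}−x_{{2}}, x_{{2}}−x_{{3}}, x_{{0,2}}−x_{{1,2}}, x_{{1,2}}−x_{{2,3}}, which are linearly independent over F; in particular J(D) is 5-dimensional. Moreover J(D)² = 0, i.e. the product of any two elements of J(D) is zero. -/

import Mathlib

set_option maxHeartbeats 1000000
set_option synthInstance.maxHeartbeats 1000000

/-- Coxeter matrix of type Bₙ, with the 4-bond between the simple reflections indexed 0 and 1,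
and 3-bonds between consecutive indices. -/
def BMat (n : ℕ) : CoxeterMatrix (Fin n) where
  M := Matrix.of fun i j : Fin n =>
    if i = j then 1
    else if min (i : ℕ) (j : ℕ) = 0 ∧ max (i : ℕ) (j : ℕ) = 1 then 4
    else if max (i : ℕ) (j : ℕ) = min (i : ℕ) (j : ℕ) + 1 then 3 else 2
  isSymm := by
    unfold Matrix.IsSymm
    ext i j
    simp only [Matrix.transpose_apply, Matrix.of_apply]
    rcases eq_or_ne i j with rfl | h
    · simp
    · rw [if_neg h, if_neg (Ne.symm h), min_comm (j : ℕ) (i : ℕ), max_comm (j : ℕ) (i : ℕ)]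
  diagonal := by simp
  off_diagonal := by
    intro i j h
    simp only [Matrix.of_apply, if_neg h]
    split_ifs <;> omega

/-- Coxeter matrix of type Dₙ: the simple reflections indexed 0 and 1 each have a 3-bond with
the one indexed 2, consecutive indices from 2 on have 3-bonds, and all other pairs commute. -/
def DMat (n : ℕ) : CoxeterMatrix (Fin n) where
  M := Matrix.of fun i j : Fin n =>
    if i = j then 1
    else if min (i : ℕ) (j : ℕ) = 0 ∧ max (i : ℕ) (j : ℕ) = 2 then 3
    else if 1 ≤ min (i : ℕ) (j : ℕ) ∧ max (i : ℕ) (j : ℕ) = min (i : ℕ) (j : ℕ) + 1 then 3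
    else 2
  isSymm := by
    unfold Matrix.IsSymm
    ext i j
    simp only [Matrix.transpose_apply, Matrix.of_apply]
    rcases eq_or_ne i j with rfl | h
    · simp
    · rw [if_neg h, if_neg (Ne.symm h), min_comm (j : ℕ) (i : ℕ), max_comm (j : ℕ) (i : ℕ)]
  diagonal := by simp
  off_diagonal := by
    intro i j h
    simp only [Matrix.of_apply, if_neg h]
    split_ifs <;> omega

open Classical in
/-- The element `x_J = ∑_{w ∈ X_J} w` of the group algebra, where
`X_J = {w : ℓ(w sᵢ) > ℓ(w) for all i ∈ J}`. -/
noncomputable def descentElt (F : Type*) [Field F] {B W : Type*} [Group W] [Fintype W]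
    {M : CoxeterMatrix B} (cs : CoxeterSystem M W) (J : Set B) : MonoidAlgebra F W :=
  ∑ w : W, if ∀ i ∈ J, cs.length w < cs.length (w * cs.simple i)
    then MonoidAlgebra.of F W w else 0

/-- The descent algebra: the `F`-subalgebra of the group algebra generated by the `x_J`. -/
noncomputable def descentAlgebra (F : Type*) [Field F] {B W : Type*} [Group W] [Fintype W]
    {M : CoxeterMatrix B} (cs : CoxeterSystem M W) : Subalgebra F (MonoidAlgebra F W) :=
  Algebra.adjoin F (Set.range (descentElt F cs))


namespace D4

/-- Byte `k` of the number `T`. -/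
def byte (T k : ℕ) : ℕ := Nat.mod (Nat.shiftRight T (Nat.mul 8 k)) 256

/-- Right multiplication by the simple reflection `i`, on indices of group elements
(four rows of 192 bytes). -/
def R (i k : ℕ) : ℕ := byte 24749560858849252498041246578850918742923058736393133407971686034186182455264524227828258530775540365955866279019852276388870942594565668546464227821808671166185378663234776188275702057093141526107024371746426739073085962075848645913465721356222980526733837971177488176628741685527036325616508316889539076303229022828312636424089929223477835991257941744771187586315792889783081511625196044944712518586613430746177985961794110522115266445531988041870969457682860215360705170844772531546785488081702028100067220294505611871554157006872059915571435952361822330267441772213264022565862167764587683371717542634278726482698122281496451309955168745365966794429289977254344882204665610599514231564688421441025460716957058880592528019708781543245691887934633950819443134191857753471478019026069769272754149411600195047165845394440597255819748379687407712749376577155806658175134074763462793238897343004385306332017955179517653242778468153045229990147424583396005177643240900862897880736234844581499515412538517492868718712151941484015764705399859678590740279031849570610959627562664679535359205616169850051721895861148708828944577052729644302682510772641975139708078508297395754309139109728208787617198139808231718028963266688994559391353054267333973388178593597462842674945266539644097630509058116367370940489620896810799859800860711749220847816377308271046993348866926977226028060337825685898462076119237053625802080686364501804636849299713536431598117108827637442214157776884575171640778621914786791683358139148415837732465674787131041626672088060413033001553904026460306492609673825773575887198355379948909014773154090307908200383642065425504020205800729256247951752124385476856303223301186303345742269763308661927120981199716912804158731272881924201701062285407321310577512498482039307836902113640717810332600931134559230045907280063909937490482983927809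 (Nat.add (Nat.mul 192 i) k)

/-- Parent in the breadth-first spanning tree. -/
def par (k : ℕ) : ℕ := byte 1767451388223604966000128787428500768103103122617438105853645865818466920675127654099181519872159083108318488398177539419609462879434930397132694241106045806348568064942359085955484766232062636223600444793443335969446430154112888205819579677644348356766538332821079505546788903497786148504808601303689604454860971104336976993871434067438135005638744749761015286503573062697657202305017506559522725493414632902925254910531700389087583548501883381762657027226599424 k

/-- Label of the edge to the parent. -/
def lastn (k : ℕ) : ℕ := byte 28356616785114099235433952168241381110699438902520932467047351049274959624451699773304821545548419666717899652728989572111297575091365918752390724849924377680517979637941216918034839647179662843865019072422407431437232151206697454679583958050650509665121218375452032933915850628453099967663939984071768704456084498352627156461518278621186691850572982273940230871709444389019827439184145143518120120829906323412203059551110226622828821259423789387952285473112064 k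

/-- Length. -/
def len (k : ℕ) : ℕ := byte 113389544471107994560903357115395074762685296956412183789060293069207605009836100874666849358187509505574575116498289009120813915660385100262247429143708655817258292129680745549176493139904474524303773968676074610303185264944311602295038134699655045518941900356412245828122833416237939421404446703543272763468316688042993813901912780570093343089563436348724867617418487648359297479941960957030447580157936747174854874617738732293685590890291299765988797574086912 k

/-- Descent set, as a bit mask. -/
def mk (k : ℕ) : ℕ := byte 141746015893660679031715292476043857343379688437991301928366892166388558871770546201092122030711597689627995070966909917290645551454468174205807686198014513134404034100197741445296944868968099784932771454808665559726170840161734767489265976643003241316199094604149390158273784911185686023333728563132879730736944241572345699629286694214343322181313572710973702931251020002465315826863253229083847793699010797703962228130812277110282774568372895206995575787618560 k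

/-- Index of the inverse. -/
def inv (k : ℕ) : ℕ := byte 1805334201318907502018792202793635606164761656855476133013576669759585050745599073644665146827483719825423546278448653967180408128254734107034187330207070603195069168075061101003760267601628839147190680085500595795825535770218104483453989706538313433399586359799767900923516692747393210760237264357607289372583077741719268790028949537538574562290918308294668314946795605128954220396069155043819728109781791380702471136167909595884526622148652431798266014359224576 k

/-- Index of a product, by following the word of the second factor. -/
def pm : ℕ → ℕ → ℕ → ℕ
  | 0, _, k => k
  | f + 1, w, k => cond (Nat.beq w 0) k (R (lastn w) (pm f (par w) k))

/-- Structure constants, packed: byte `16 A + B` of entry `C`. -/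
def Tt : List ℕ := [
  126238304966058622268417487065116999845487680003812908870115767972785003263711901760196535578698150776050768164854016099453552687327521967859006297679086659054418929160395911435900469340274236392712469613557007193306125521896866250924296343770178558809577318599144514158265796050371658002243877403126983016572807220023802271184714927238464665468190515344317926838431714294898673180134110283978356547503361845324422768359080970831492797026023650499080068621062257962884982238061121473477260191380964611967302219100164507497639151648952922830186877515450165982764795864344009010698432087055493023315513638340333142017,
  493118378773666493236005808848113281018855109191983005925600603245617333781037629156764575213784883514713536703555112688360655555594447992718481685912506524288155528804339497405556252399915382871327079550984225316454469217066835608562573400622706013699298528346216736451841028255333448900290853242766840414964660595330466486838619231285745358613381625406910166975973583889856043149590962484685371984257281196232873608769849404080018051855125511913015393687613783821982721817163929465335409876734721864838848594306085662177818251887032222689059830864044695563973482410595176873127892476815937571494659895523803392,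
  1926243667084634739203147690812942502530802322991775390905106349397384739012946316897951880673815075282803486321041761524341028002139575366673588654538953411713005003040021962970169341861979573913381833792033891207654084199537485062456611308003495624865628092477596588600383860007280734738952792154457863087549447252202240850895772515695510835004414184800699157526290783905195300544993895257970441682878575771545602881736238596754281790753351012002718427469966599463055025324979177374601734563466656121582271449652950225225700415859398531867729411984856680681641372377297385700143489179021806336533997453115392,
  7524389324549354450012295667238056656193607389266713420462312470209600951682697601804695733062620411959273014339377589340395863739924106638712535802153388727206712178842292063991406359658398948646280404921962080894750930146140101144141759089479695059258052280893698861755299184627631565416178831843921524500079291880580746054094422185987927802949109089643942498886015944431922909927886683580374645083761020150462133194930684505214858741817939610312251104388632414543865496006462129600189332273128517119099988139008608947275897053849481362123397786909295669726238895960791837666754398389710311484713590587392,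
  29392145799020915820360529950150107935815761128409040392530175867985132049744993271109783239532615887723479894602026413604841548166254806910399493110791852196178094251657651422158882619445425950386799077405846649869843126812361860422339121742661784753201002812548319797723000723608889774317712949462305631050744240991955792380522538401768960411158708608077037633000943050746372564186063294328703698145997344069416660985658206339458155740965594261118919551767349698867367069856661540141306756812286480144795817986199811253492409306834195000548866182091224056839780650143972636831876351515896331310718779392,
  114813069527425452423283320119217343246658412306307886966149425614905944073856502064568625568497618820217362407603140395202241797644463399472972868831505179744043080804068735084806275417027377457749107475739927990129052543799633848697900225425328825772081176116963198218226246631197903113873758013351134477442217738917193278975406370683255863554005042906591600623717033612798685525219290898335050821472679313553177054866313710204850610960404444709647758281880707039613684182496437342672543444068099246544455799323109568711744689088817306847855376123587853478530849762276963563611025931103087063195451392,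
  448488552841505673528450469210054223579973331045956144213350240068339243195986353478935522814282960691259852858151663330018338642302021213380865358091836031969405163609963943797994226579872492210438916315433450119943819508560643614248855058676755316477352603662024780828846070896395019196148117737093836800886440195901011816855814817153343715221983799519345668566680668467004305494672176911123194472127805643089817375126036806957056107925240916029528726653733970614622822785399184430776274481315412328306538206424850185255550248365420674003263450882806273160625645714001731823219873196299776941883392,
  1751908409537131537220509645373800130597706117953870328543794061097471134379770333708244760582424559731753781145877575895178604897598628599045987767299547012683472614326424207716891150985614235982966302325758523728056789760534088321043296299564523574481252368622610483074761775997008089551117434247870075918438530621928214809482896411863251248630087554652469850980191692322959622768417592995605500176914320932124175029825149810197974763110952921259788216940155130611174333012428108351270026951950034557909758611373477679326976139042056830132740093057853924973014238652163174813781303066035740475392,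
  6843392224754420067267621462962777844849285306249912154614199507614679725842895827712513113619155844629210101121366603147967651071986597006846856420599331335056446555265549807837943715200311346943581593281788505463988016586212960746036189858889834502673962825641925461670150258331760236819422984746849960381736704078258052695271165146715061082223629087696200587381990962144453481850811637917999160574881104430554663325119125031353787312129457753278025481429039118776030304478884753966063913803079960733609206745896472819810552964439199617084326656635801477750675570023406723839724715309522747392,
  26732000877946953387764146339698350976631387537257361867365903779563798009057254634038942760809693276121508589107695076994744269777549684782505437701165147653969736970677333661414370617454480264898798076679406696396168252214752352859526973238028650077260642987612208591430476945160932714389407107757183151261986702791162292171664997478350004243917020162418867414861743612864724021029299458013312291216960793178985746542346132308308208784738474028482109862845053182758731885946228955474564544428805069563373913161965218366357327550080119373408468288078168295258627423327846686116392398217019392,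
  104421878429480286676614418010541702165078232537413254934773388614928173320933147549867794570756019992721441956385610870988794740577116576092706632311257715969025271608156266987733911998421163703788339259077868163354275739821932929357793380226956062338513254182457030149587031921298384843543230353243173788350151281155460934209426266588414231485094351889698783326661211405521159632864406626655784955902487763132946710185811087925819133309364280483455275765040120396828920624072618732406382506795152350323112631265605075378930367995344584805225825146733606962503755496320156025548182642491392,
  407897962615157369830525070353678524390394505909674618174837866796349604799535043026780606397223196274444895114449654235630208248227047563859733483417766439715791151355246374793935210453886269312669687977802044705356260141800070161526564831152962790584386313681067753046135153997227786963609588978150441392023783411653073913030165290247499950466083864665864692541686956025357677375608877043326720090721706650474032623619184520418285844618040935083227774699926519810052159976335830292189380495352962262674158727316688329060400213752607871240729998419882619864312851942225230054604922683392,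
  1593351416465458475900488556069135292991337959976941667075230773139223953085975688093397042549678437407845202535282744152182526863442653700952082980437085133219553746175325833847111505591406208775985091568648042140406423821040868311887586347438796851301927576123969726601186660813826714785882220794705895068830508258819454435265163994408664955406407911365339636495470950987352808821958983541028040673395894963415335999104864459819935313778854355177119144036434490174796122218108706516384653844345582151884234167045443830624598524793174010295917002019281852694787358123961875377938235392,
  6224028970568197171486283422223311169318947045063305310726519780278889058058016785398172195214684744983775151176948420823148361090428385367045834834327168864894187240423805020933279551205176037942510094903311869380472968306228923445011074108031485182255277786575155589123308418617868059271129949831724600072343302385071032293381820594314343642755109693238509835733949983214044951582682519622673249663481444006404229172872349923173215625544323771435798382026915579483009679666005432532046306681506134572751142948390144300752834891838160292720886801827918721245449680997987585613627392,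
  24312613166282106576871637742429760248219046403646851005668513756593013826844426411567360269614160270980151566310044193349294868121866152387954558061332983314788430338291422180536635813896835686866820848546370750821180540114012853901980597749008877067500641475258394788711454156423762778052695036747716379375617392026727235276112151942370493624502096834672294820197306719137587844750435070409815569086008595319180875192055277455572087526010162705339056406550404609288403689758594134970279618052527096546952458545569512883705682339857305197921121605554466108972177471337275580219392,
  94971145180789478815904834932560273050164932529250652788773179540887558456239279405892704401587315779968497073011174325661117142312159568637412488044690541388304838709611693766947787212147821939703896448075098247293287898096710938823251699276453223616865241134044409890798664611987189991211137307324145873270562309419981663662957645568552100180706545749045222785441554715054080087433378983018105400956697953776978995898269612528800374314203414709183539167064464406073318517008659479131890159688729365252906395786624754584160630587409896966563340792910804972523962842003529531392]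

/-- Structure constants in the basis of descent classes. -/
def nn (A B C : ℕ) : ℕ := byte (Tt.getD C 0) (Nat.add (Nat.mul 16 A) B)

/-- The eleven characters. -/
def Xt : List (List ℤ) := [
  [1, 7, 7, 17, 23, 17, 17, 7, 7, 17, 17, 23, 17, 7, 7, 1],
  [1, 3, 3, 1, 5, -1, -1, -3, 3, 1, 1, -5, -1, -3, -3, -1],
  [1, -1, -1, 1, 3, -3, -3, 3, 3, -3, -3, 3, 1, -1, -1, 1],
  [1, -1, 3, -3, 3, -3, 1, -1, -1, 1, -3, 3, -3, 3, -1, 1],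
  [1, 3, -1, -3, 3, 1, -3, -1, -1, -3, 1, 3, -3, -1, 3, 1],
  [1, 1, 1, -1, -1, -1, -1, 1, 1, -1, -1, -1, -1, 1, 1, 1],
  [1, -1, -1, 1, -1, 1, 1, -1, 1, -1, -1, 1, -1, 1, 1, -1],
  [1, -1, 1, -1, -1, 1, -1, 1, -1, 1, -1, 1, 1, -1, 1, -1],
  [1, 1, -1, -1, -1, -1, 1, 1, -1, -1, 1, 1, 1, 1, -1, -1],
  [1, -1, -1, 1, 1, -1, -1, 1, -1, 1, 1, -1, -1, 1, 1, -1],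
  [1, -1, -1, 1, -1, 1, 1, -1, -1, 1, 1, -1, 1, -1, -1, 1]]

def et : List (List ℤ) := [
  [1, 1, 1, 1, 1, 1, 1, 1, 1, 1, 1, 1, 1, 1, 1, 1],
  [12, -12, 12, -12, 12, -12, 12, -12, 12, -12, 12, -12, 12, -12, 12, -12],
  [6, 6, -18, 6, 6, 6, -18, 6, 6, 6, -18, 6, 6, 6, -18, 6],
  [6, 6, 6, 6, 6, 6, 6, 6, -18, 6, -18, 6, -18, 6, -18, 6],
  [6, 30, -18, 6, 6, 30, -18, 6, -18, 6, -18, 6, -18, 6, -18, 6],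
  [32, 32, 32, 32, -64, 32, -64, 32, 32, 32, 32, 32, -64, 32, -64, 32],
  [24, -24, -24, -24, 24, -24, 72, -24, 24, -24, -24, -24, 24, -24, 72, -24],
  [24, -24, 24, -24, 24, -24, 24, -24, -24, -24, -24, -24, 72, -24, 72, -24],
  [24, 24, -24, -24, 24, -72, 72, -24, -24, -24, -24, -24, 72, -24, 72, -24],
  [12, -60, 12, -12, 12, -60, 12, -12, 12, -12, 60, -12, 12, -12, 60, -12],
  [45, 21, -3, 45, -51, 117, -99, 45, -3, 45, 21, 45, -99, 45, -171, 45]]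

def bt : List (List ℤ) := [
  [0, 0, 0, 0, 0, 0, 0, -1, 0, 0, 0, -1, 0, -1, 0, 3],
  [0, 0, 0, 0, 0, 0, 0, -1, 0, 0, 0, -1, 0, 0, 0, 2],
  [0, 0, 0, 0, 0, 0, 0, -1, 0, 0, 0, 0, 0, 0, 0, 1],
  [0, 0, 0, -1, 0, 0, 0, 1, 0, -1, 0, 2, 0, 1, 0, -2],
  [0, 0, 0, -1, 0, 0, 0, 1, 0, 0, 0, 1, 0, 0, 0, -1]]

def avt : List (List ℤ) := [
  [0, -1, 1, 0, 0, -1, 1, 0, 0, -1, 1, 0, 0, -1, 1, 0],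
  [0, 0, -1, -1, 1, 1, 0, 0, 0, 0, -1, -1, 1, 1, 0, 0],
  [0, 0, 0, 0, -1, -1, -1, -1, 1, 1, 1, 1, 0, 0, 0, 0],
  [0, -1, 1, 0, 0, 0, 0, 0, 0, -1, 1, 0, 0, 0, 0, 0],
  [0, 0, -1, -1, 0, 0, 0, 0, 1, 1, 0, 0, 0, 0, 0, 0]]

def ent (M : List (List ℤ)) (i j : ℕ) : ℤ := (M.getD i []).getD j 0

open Finset


theorem R_lt : ∀ i < 4, ∀ k < 192, R i k < 192 := by decide +kernel
theorem R_R : ∀ i < 4, ∀ k < 192, R i (R i k) = k := by decide +kernel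
theorem R_rel : ∀ i : Fin 4, ∀ j : Fin 4, ∀ k < 192,
    (fun x => R i (R j x))^[DMat 4 i j] k = k := by decide +kernel
theorem tree : ∀ k < 192, 0 < k → lastn k < 4 ∧ par k < k ∧ R (lastn k) (par k) = k ∧
    len k = len (par k) + 1 := by decide +kernel
theorem len_R : ∀ i < 4, ∀ k < 192, len (R i k) ≤ len k + 1 := by decide +kernel
theorem mk_spec : ∀ i < 4, ∀ k < 192, (len k < len (R i k) ↔ (mk k).testBit i = false) := by
  decide +kernel
theorem mk_lt : ∀ k < 192, mk k < 16 := by decide +kernel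
theorem inv_spec : ∀ k < 192, inv k < 192 ∧ pm 12 (inv k) k = 0 := by decide +kernel
/-- Edge label as an element of `Fin 4`. -/
def last (k : ℕ) : Fin 4 := ⟨lastn k % 4, Nat.mod_lt _ (by norm_num)⟩

theorem last_val : ∀ k < 192, (last k).val = lastn k := by decide +kernel
theorem braid2 : ∀ i : Fin 4, ∀ k < 192, k < R i k → DMat 4 i (last (R i k)) = 2 →
    R (last (R i k)) k < k ∧ R i (par (R i k)) = R (last (R i k)) k ∧
      R (last (R i k)) k < par (R i k) := by decide +kernel
theorem braid3 : ∀ i : Fin 4, ∀ k < 192, k < R i k → DMat 4 i (last (R i k)) = 3 →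
    R (last (R i k)) k < k ∧ R i (R (last (R i k)) k) < R (last (R i k)) k ∧
    R i (par (R i k)) < par (R i k) ∧
    R (last (R i k)) (R i (par (R i k))) = R i (R (last (R i k)) k) ∧
    R i (R (last (R i k)) k) < R i (par (R i k)) := by decide +kernel
theorem mk_zero : ∀ k < 192, mk k = 0 → k = 0 := by decide +kernel
theorem mk_surj : ∀ C < 16, ∃ k < 192, mk k = C := by decide +kernel

/-- A sum of integers, in a form that evaluates fast. -/
def sumZ (n : ℕ) (f : ℕ → ℤ) : ℤ := Nat.rec 0 (fun k s => Int.add s (f k)) n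

theorem sumZ_eq (n : ℕ) (f : ℕ → ℤ) : sumZ n f = ∑ i ∈ range n, f i := by
  induction n with
  | zero => rfl
  | succ n ih => rw [sum_range_succ, ← ih]; rfl

theorem Xmul' : ∀ k < 11, ∀ A < 16, ∀ B < 16,
    sumZ 16 (fun C => Int.mul (Int.ofNat (nn A B C)) (ent Xt k C)) =
      Int.mul (ent Xt k A) (ent Xt k B) := by decide +kernel
theorem Xmul : ∀ k < 11, ∀ A < 16, ∀ B < 16,
    ∑ C ∈ range 16, (nn A B C : ℤ) * ent Xt k C = ent Xt k A * ent Xt k B := by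
  intro k hk A hA B hB
  rw [← sumZ_eq]
  exact Xmul' k hk A hA B hB
theorem at_at' : ∀ i < 5, ∀ j < 5, ∀ C < 16,
    sumZ 16 (fun A => if ent avt i A = 0 then 0 else
      sumZ 16 (fun B => if ent avt j B = 0 then 0 else
        Int.mul (Int.mul (Int.ofNat (nn A B C)) (ent avt i A)) (ent avt j B))) = 0 := by
  decide +kernel
theorem at_at : ∀ i < 5, ∀ j < 5, ∀ C < 16, ∑ A ∈ range 16, ∑ B ∈ range 16,
    (nn A B C : ℤ) * ent avt i A * ent avt j B = 0 := by
  intro i hi j hj C hC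
  rw [← at_at' i hi j hj C hC, sumZ_eq]
  refine sum_congr rfl fun A _ => ?_
  split_ifs with h
  · simp [h]
  · rw [sumZ_eq]
    refine sum_congr rfl fun B _ => ?_
    split_ifs with h2
    · simp [h2]
    · rfl
theorem resolve : ∀ A < 16, ∀ B < 16,
    192 * ∑ j ∈ range 5, ent bt j A * ent avt j B + ∑ k ∈ range 11, ent Xt k A * ent et k B
      = if A = B then 192 else 0 := by decide +kernel
theorem Xat : ∀ k < 11, ∀ j < 5, ∑ A ∈ range 16, ent Xt k A * ent avt j A = 0 := by
  decide +kernel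
theorem bat : ∀ i < 5, ∀ j < 5, ∑ A ∈ range 16, ent bt i A * ent avt j A
    = if i = j then 1 else 0 := by decide +kernel

theorem bigcheck : ∀ w < 192,
    ∑ u ∈ range 192, 256 ^ (16 * mk u + mk (pm 12 w (inv u))) = Tt.getD (mk w) 0 := by
  decide +kernel

section group

variable {W : Type*} [Group W] (cs : CoxeterSystem (DMat 4) W)

/-- The permutation of the indices given by right multiplication by `i`. -/
def rho (i : Fin 4) : Equiv.Perm (Fin 192) where
  toFun k := ⟨R i k, R_lt i i.2 k k.2⟩
  invFun k := ⟨R i k, R_lt i i.2 k k.2⟩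
  left_inv k := Fin.ext (R_R i i.2 k k.2)
  right_inv k := Fin.ext (R_R i i.2 k k.2)

theorem rho_liftable : (DMat 4).IsLiftable rho := by
  intro i j
  have h : ∀ (n : ℕ) (k : Fin 192),
      (((rho i * rho j) ^ n) k).val = (fun x => R i (R j x))^[n] k.val := by
    intro n
    induction n with
    | zero => intro k; rfl
    | succ n ih =>
      intro k
      rw [pow_succ, Equiv.Perm.mul_apply, ih, Function.iterate_succ_apply]
      rfl
  ext k
  rw [h, R_rel i j k k.2]
  rfl

/-- The permutation representation. -/
noncomputable def phi : W →* Equiv.Perm (Fin 192) := cs.lift ⟨rho, rho_liftable⟩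

/-- The index of a group element. -/
noncomputable def idx (w : W) : ℕ := (phi cs w⁻¹ 0).val

theorem idx_lt (w : W) : idx cs w < 192 := (phi cs w⁻¹ 0).2

theorem idx_one : idx cs 1 = 0 := by simp [idx]

theorem idx_mul (w : W) (i : Fin 4) : idx cs (w * cs.simple i) = R i (idx cs w) := by
  have : phi cs (cs.simple i) = rho i := cs.lift_apply_simple rho_liftable i
  simp only [idx, mul_inv_rev, cs.inv_simple, map_mul, this, Equiv.Perm.mul_apply]
  rfl

open Classical in
/-- The group element with a given index. -/
noncomputable def g (k : ℕ) : W :=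
  if _h : 0 < k ∧ par k < k then g (par k) * cs.simple (last k) else 1
termination_by k
decreasing_by exact _h.2

theorem g_zero : g cs 0 = 1 := by rw [g]; simp

theorem g_pos {k : ℕ} (hk : k < 192) (h0 : 0 < k) :
    g cs k = g cs (par k) * cs.simple (last k) := by
  rw [g, dif_pos ⟨h0, (tree k hk h0).2.1⟩]

theorem dmat_cases' : ∀ i j : Fin 4, i ≠ j → (DMat 4).M i j ≠ 2 → (DMat 4).M i j = 3 := by
  intro i j
  fin_cases i <;> fin_cases j <;> simp [DMat]

theorem dmat_cases (i j : Fin 4) : i = j ∨ DMat 4 i j = 2 ∨ DMat 4 i j = 3 := by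
  by_cases h : i = j
  · exact Or.inl h
  · by_cases h2 : DMat 4 i j = 2
    · exact Or.inr (Or.inl h2)
    · exact Or.inr (Or.inr (dmat_cases' i j h h2))

theorem comm2 {i j : Fin 4} (h : DMat 4 i j = 2) :
    cs.simple i * cs.simple j = cs.simple j * cs.simple i := by
  have h1 := cs.simple_mul_simple_pow i j
  rw [h, pow_two, mul_eq_one_iff_eq_inv, mul_inv_rev, cs.inv_simple, cs.inv_simple] at h1
  exact h1

theorem comm3 {i j : Fin 4} (h : DMat 4 i j = 3) :
    cs.simple i * cs.simple j * cs.simple i = cs.simple j * cs.simple i * cs.simple j := by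
  have h1 := cs.simple_mul_simple_pow i j
  have h2 : (cs.simple i * cs.simple j * cs.simple i) *
      (cs.simple j * cs.simple i * cs.simple j) = 1 := by
    rw [h] at h1
    simpa [pow_succ, mul_assoc] using h1
  rw [mul_eq_one_iff_eq_inv] at h2
  rw [h2]
  simp [mul_assoc]

theorem g_mul_up : ∀ K < 192, ∀ k < K, ∀ i : Fin 4, R i k = K →
    g cs k * cs.simple i = g cs K := by
  intro K
  induction K using Nat.strong_induction_on with
  | _ K ih =>
    intro hK k hk i hi
    obtain ⟨-, hp, hR, -⟩ := tree K hK (by omega)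
    have hK' := g_pos cs hK (by omega)
    have hl := last_val K hK
    rw [← hl] at hR
    rw [hK']
    rcases dmat_cases i (last K) with h | h | h
    · have : k = par K := by
        have h1 := R_R i i.2 k (by omega)
        have h2 := R_R i i.2 (par K) (by omega)
        rw [hi] at h1
        rw [h, hR, ← h, h1] at h2
        exact h2
      rw [this, h]
    · have hb := braid2 i k (by omega) (by omega)
      rw [hi] at hb
      obtain ⟨b1, b2, b3⟩ := hb h
      have e1 := ih k hk (by omega) _ b1 (last K) (R_R _ (last K).2 k (by omega))
      have e2 := ih (par K) hp (by omega) _ b3 i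
        (by rw [← b2]; exact R_R _ i.2 _ (by omega))
      rw [← e1, ← e2, mul_assoc, mul_assoc, comm2 cs h]
    · have hb := braid3 i k (by omega) (by omega)
      rw [hi] at hb
      obtain ⟨b1, b2, b3, b4, b5⟩ := hb h
      have e1 := ih k hk (by omega) _ b1 (last K) (R_R _ (last K).2 k (by omega))
      have e2 := ih (R (last K) k) (by omega) (by omega) _ b2 i (R_R _ i.2 _ (by omega))
      have e3 := ih (par K) hp (by omega) _ b3 i (R_R _ i.2 _ (by omega))
      have e4 := ih (R i (par K)) (by omega) (by omega) _ b5 (last K)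
        (by rw [← b4]; exact R_R _ (last K).2 _ (by omega))
      rw [← e1, ← e2, ← e3, ← e4]
      have := comm3 cs h
      simp only [mul_assoc] at this ⊢
      rw [this]

theorem R_ne : ∀ i < 4, ∀ k < 192, R i k ≠ k := by decide +kernel

theorem g_mul {k : ℕ} (hk : k < 192) (i : Fin 4) : g cs k * cs.simple i = g cs (R i k) := by
  have h1 := R_lt i i.2 k hk
  rcases lt_or_gt_of_ne (R_ne i i.2 k hk) with h | h
  · rw [← g_mul_up cs k hk _ h i (R_R i i.2 k hk)]
    simp
  · exact g_mul_up cs _ h1 k h i rfl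

theorem g_idx (w : W) : g cs (idx cs w) = w := by
  induction w using cs.simple_induction_right with
  | one => rw [idx_one, g_zero]
  | mul_simple_right w i ih => rw [idx_mul, ← g_mul cs (idx_lt cs w), ih]

theorem idx_g : ∀ k < 192, idx cs (g cs k) = k := by
  intro k
  induction k using Nat.strong_induction_on with
  | _ k ih =>
    intro hk
    rcases Nat.eq_zero_or_pos k with rfl | h0
    · rw [g_zero, idx_one]
    · obtain ⟨-, hp, hR, -⟩ := tree k hk h0
      rw [g_pos cs hk h0, idx_mul, ih _ hp (by omega), last_val k hk, hR]

theorem len_zero : len 0 = 0 := by decide +kernel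

theorem length_eq (w : W) : cs.length w = len (idx cs w) := by
  apply le_antisymm
  · have : ∀ k < 192, cs.length (g cs k) ≤ len k := by
      intro k
      induction k using Nat.strong_induction_on with
      | _ k ih =>
        intro hk
        rcases Nat.eq_zero_or_pos k with rfl | h0
        · simp [g_zero]
        · obtain ⟨-, hp, hR, hl⟩ := tree k hk h0
          rw [g_pos cs hk h0, hl]
          refine (cs.length_mul_le _ _).trans ?_
          rw [cs.length_simple]
          exact Nat.add_le_add_right (ih _ hp (by omega)) 1
    have h := this _ (idx_lt cs w)
    rwa [g_idx] at h
  · have : ∀ l : List (Fin 4), len (idx cs (cs.wordProd l)) ≤ l.length := by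
      intro l
      induction l using List.reverseRecOn with
      | nil => simp [idx_one, len_zero]
      | append_singleton l i ih =>
        rw [cs.wordProd_append, cs.wordProd_singleton, idx_mul, List.length_append]
        exact (len_R i i.2 _ (idx_lt cs _)).trans (Nat.add_le_add_right ih 1)
    obtain ⟨l, hl, rfl⟩ := cs.exists_isReduced w
    rw [hl.eq]
    exact this l

theorem desc_iff (w : W) (i : Fin 4) :
    cs.length w < cs.length (w * cs.simple i) ↔ (mk (idx cs w)).testBit i = false := by
  rw [length_eq, length_eq, idx_mul]
  exact mk_spec i i.2 _ (idx_lt cs w)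

theorem len_le : ∀ k < 192, len k ≤ 12 := by decide +kernel

theorem pm_spec (f : ℕ) : ∀ w < 192, len w ≤ f → ∀ k < 192,
    g cs (pm f w k) = g cs k * g cs w ∧ pm f w k < 192 := by
  induction f with
  | zero =>
    intro w hw hl k hk
    rcases Nat.eq_zero_or_pos w with rfl | h0
    · simp [pm, g_zero, hk]
    · have := (tree w hw h0).2.2.2
      omega
  | succ f ih =>
    intro w hw hl k hk
    rcases Nat.eq_zero_or_pos w with rfl | h0
    · simp [pm, g_zero, hk]
    · obtain ⟨h4, hp, hR, hl'⟩ := tree w hw h0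
      obtain ⟨i1, i2⟩ := ih (par w) (by omega) (by omega) k hk
      have : pm (f + 1) w k = R (last w) (pm f (par w) k) := by
        rw [last_val w hw]
        have hb : Nat.beq w 0 = false := by
          rw [Bool.eq_false_iff, Ne, Nat.beq_eq]; omega
        simp [pm, hb]
      rw [this, ← g_mul cs i2, i1, g_pos cs hw h0, mul_assoc]
      exact ⟨rfl, R_lt _ (last w).2 _ i2⟩

theorem idx_inv (u : W) : idx cs u⁻¹ = inv (idx cs u) := by
  obtain ⟨h1, h2⟩ := inv_spec _ (idx_lt cs u)
  have h := (pm_spec cs 12 _ h1 (len_le _ h1) _ (idx_lt cs u)).1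
  rw [h2, g_zero, g_idx] at h
  rw [← eq_inv_of_mul_eq_one_right h.symm, idx_g cs _ h1]

theorem idx_inv_mul (u w : W) :
    idx cs (u⁻¹ * w) = pm 12 (idx cs w) (inv (idx cs u)) := by
  have h1 := (inv_spec _ (idx_lt cs u)).1
  obtain ⟨h, h3⟩ := pm_spec cs 12 _ (idx_lt cs w) (len_le _ (idx_lt cs w)) _ h1
  rw [← idx_inv, g_idx, g_idx] at h
  rw [← h, ← idx_inv, idx_g]
  rwa [idx_inv]

/-- The bijection between indices and group elements. -/
noncomputable def eqv : W ≃ Fin 192 where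
  toFun w := ⟨idx cs w, idx_lt cs w⟩
  invFun k := g cs k
  left_inv w := g_idx cs w
  right_inv k := Fin.ext (idx_g cs k k.2)

/-- Digit extraction. -/
theorem byte_sum (n : ℕ) (c : ℕ → ℕ) (hc : ∀ i, c i < 256) (j : ℕ) (hj : j < n) :
    byte (∑ i ∈ Finset.range n, c i * 256 ^ i) j = c j := by
  have hb : ∀ T k, byte T k = T / 256 ^ k % 256 := by
    intro T k
    change (T >>> (8 * k)) % 256 = _
    rw [Nat.shiftRight_eq_div_pow, pow_mul]
    norm_num
  rw [hb]
  induction n generalizing c j with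
  | zero => omega
  | succ n ih =>
    rw [Finset.sum_range_succ']
    have e : ∑ i ∈ Finset.range n, c (i + 1) * 256 ^ (i + 1) =
        256 * ∑ i ∈ Finset.range n, c (i + 1) * 256 ^ i := by
      rw [Finset.mul_sum]
      exact Finset.sum_congr rfl fun i _ => by ring
    rw [e]
    cases j with
    | zero =>
      have := hc 0
      simp only [pow_zero, Nat.div_one, mul_one]
      omega
    | succ j =>
      rw [pow_succ', ← Nat.div_div_eq_div_mul]
      have : (256 * ∑ i ∈ Finset.range n, c (i + 1) * 256 ^ i + c 0 * 256 ^ 0) / 256 =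
          ∑ i ∈ Finset.range n, c (i + 1) * 256 ^ i := by
        have := hc 0
        omega
      rw [this]
      exact ih (fun i => c (i + 1)) (fun i => hc _) j (by omega)

variable [Fintype W]

theorem card_W (cs : CoxeterSystem (DMat 4) W) : Fintype.card W = 192 := by
  rw [Fintype.card_congr (eqv cs), Fintype.card_fin]

/-- Solomon's theorem for `D₄`: the number of factorisations depends only on descent sets. -/
theorem solomon (w : W) (A B : ℕ) (hA : A < 16) (hB : B < 16) :
    (Finset.univ.filter fun u : W =>
      mk (idx cs u) = A ∧ mk (idx cs (u⁻¹ * w)) = B).card = nn A B (mk (idx cs w)) := by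
  classical
  have hlt : ∀ u : W, mk (idx cs u) < 16 := fun u => mk_lt _ (idx_lt cs u)
  let f : W → ℕ := fun u => 16 * mk (idx cs u) + mk (idx cs (u⁻¹ * w))
  have h1 : ∑ u : W, 256 ^ f u = Tt.getD (mk (idx cs w)) 0 := by
    rw [← bigcheck _ (idx_lt cs w), ← Fin.sum_univ_eq_sum_range
      (fun u => 256 ^ (16 * mk u + mk (pm 12 (idx cs w) (inv u))))]
    refine Fintype.sum_equiv (eqv cs) _ _ fun u => ?_
    simp only [f, idx_inv_mul]
    rfl
  have h2 : ∑ u : W, 256 ^ f u = ∑ i ∈ Finset.range 256,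
      (Finset.univ.filter fun u : W => f u = i).card * 256 ^ i := by
    rw [← Finset.sum_fiberwise_of_maps_to (t := Finset.range 256) (g := f)]
    · refine Finset.sum_congr rfl fun i _ => ?_
      rw [Finset.sum_congr rfl (g := fun _ => 256 ^ i), Finset.sum_const, smul_eq_mul]
      intro u hu
      rw [(Finset.mem_filter.1 hu).2]
    · intro u _
      have := hlt u
      have := hlt (u⁻¹ * w)
      simp only [Finset.mem_range, f]
      omega
  have h3 := byte_sum 256 (fun i => (Finset.univ.filter fun u : W => f u = i).card)
    (fun i => lt_of_le_of_lt (Finset.card_le_univ _) (by rw [card_W cs]; norm_num))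
    (16 * A + B) (by omega)
  rw [← h2, h1] at h3
  have h4 : nn A B (mk (idx cs w)) = byte (Tt.getD (mk (idx cs w)) 0) (16 * A + B) := rfl
  rw [h4, h3]
  congr 1
  ext u
  have := hlt u
  have := hlt (u⁻¹ * w)
  simp only [Finset.mem_filter, Finset.mem_univ, true_and, f]
  omega

end group

section algebra

variable {F : Type*} [Field F] {W : Type*} [Group W] [Fintype W]
  (cs : CoxeterSystem (DMat 4) W)

/-- The element of the group algebra whose coefficients are a function of the descent set. -/
noncomputable def th (v : ℕ → F) : MonoidAlgebra F W :=
  ∑ w : W, MonoidAlgebra.single w (v (mk (idx cs w)))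

theorem th_coeff (v : ℕ → F) (w : W) : (th cs v).coeff w = v (mk (idx cs w)) := by
  classical
  simp [th, MonoidAlgebra.coeff_sum, Finsupp.finsetSum_apply, Finsupp.single_apply]

theorem th_congr {v v' : ℕ → F} (h : ∀ A < 16, v A = v' A) : th cs v = th cs v' := by
  unfold th
  exact Finset.sum_congr rfl fun w _ => by rw [h _ (mk_lt _ (idx_lt cs w))]

theorem th_inj {v v' : ℕ → F} (h : th cs v = th cs v') : ∀ A < 16, v A = v' A := by
  intro A hA
  obtain ⟨k, hk, rfl⟩ := mk_surj A hA
  have := congrArg (fun f => f.coeff (g cs k)) h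
  simpa only [th_coeff, idx_g cs k hk] using this

theorem th_add (v v' : ℕ → F) : th cs v + th cs v' = th cs (fun A => v A + v' A) := by
  simp [th, ← Finset.sum_add_distrib]

theorem th_sub (v v' : ℕ → F) : th cs v - th cs v' = th cs (fun A => v A - v' A) := by
  simp [th, ← Finset.sum_sub_distrib]

theorem th_smul (c : F) (v : ℕ → F) : c • th cs v = th cs (fun A => c * v A) := by
  simp [th, Finset.smul_sum]

theorem th_one : th cs (fun A => if A = 0 then (1 : F) else 0) = 1 := by
  classical
  have h0 : mk 0 = 0 := by decide +kernel
  unfold th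
  rw [Finset.sum_eq_single (1 : W)]
  · simp [idx_one, h0, MonoidAlgebra.one_def]
  · intro w _ hw
    beta_reduce
    rw [if_neg, MonoidAlgebra.single_zero]
    intro h
    apply hw
    rw [← g_idx cs w, mk_zero _ (idx_lt cs w) h, g_zero]
  · simp

theorem th_mul (v v' : ℕ → F) : th cs v * th cs v' =
    th cs (fun C => ∑ A ∈ range 16, ∑ B ∈ range 16, (nn A B C : F) * v A * v' B) := by
  classical
  have h1 : th cs v * th cs v' = ∑ w : W, MonoidAlgebra.single w
      (∑ u : W, v (mk (idx cs u)) * v' (mk (idx cs (u⁻¹ * w)))) := by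
    have hs : ∀ (w : W) (f : W → F), MonoidAlgebra.single w (∑ u, f u) =
        ∑ u, MonoidAlgebra.single w (f u) := fun w f =>
      map_sum (MonoidAlgebra.singleAddHom w : F →+ MonoidAlgebra F W) f univ
    unfold th
    rw [Finset.sum_mul_sum]
    simp only [MonoidAlgebra.single_mul_single, hs]
    rw [Finset.sum_comm (s := (univ : Finset W)) (t := (univ : Finset W))
      (f := fun w u => MonoidAlgebra.single w (v (mk (idx cs u)) * v' (mk (idx cs (u⁻¹ * w)))))]
    refine Finset.sum_congr rfl fun u _ => ?_
    refine Fintype.sum_equiv (Equiv.mulLeft u) _ _ fun x => ?_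
    simp
  rw [h1]
  unfold th
  refine Finset.sum_congr rfl fun w _ => ?_
  congr 1
  beta_reduce
  have h2 : ∀ A ∈ range 16, ∀ B ∈ range 16,
      (nn A B (mk (idx cs w)) : F) * v A * v' B =
      ∑ u : W, if mk (idx cs u) = A ∧ mk (idx cs (u⁻¹ * w)) = B then v A * v' B else 0 := by
    intro A hA B hB
    rw [← solomon cs w A B (mem_range.1 hA) (mem_range.1 hB), ← Finset.sum_filter,
      Finset.sum_const, nsmul_eq_mul, mul_assoc]
  rw [Finset.sum_congr rfl fun A hA => Finset.sum_congr rfl fun B hB => h2 A hA B hB]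
  rw [Finset.sum_congr rfl fun A hA => Finset.sum_comm, Finset.sum_comm]
  refine Finset.sum_congr rfl fun u _ => ?_
  have hu := mk_lt _ (idx_lt cs u)
  have hw := mk_lt _ (idx_lt cs (u⁻¹ * w))
  rw [Finset.sum_eq_single (mk (idx cs u)), Finset.sum_eq_single (mk (idx cs (u⁻¹ * w)))]
  · simp
  · intro B _ hB
    rw [if_neg fun h => hB h.2.symm]
  · intro h; exact absurd (mem_range.2 hw) h
  · intro A _ hA
    refine Finset.sum_eq_zero fun B _ => ?_
    rw [if_neg fun h => hA h.1.symm]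
  · intro h; exact absurd (mem_range.2 hu) h

/-- The characters, on coordinate vectors. -/
noncomputable def ch (k : ℕ) (v : ℕ → F) : F := ∑ A ∈ range 16, (ent Xt k A : F) * v A

theorem ch_lin (k : ℕ) (c : F) (v v' : ℕ → F) :
    ch k (fun A => c * v A + v' A) = c * ch k v + ch k v' := by
  simp only [ch, Finset.mul_sum, ← Finset.sum_add_distrib]
  exact Finset.sum_congr rfl fun A _ => by ring

theorem ch_congr (k : ℕ) {v v' : ℕ → F} (h : ∀ A < 16, v A = v' A) : ch k v = ch k v' :=
  Finset.sum_congr rfl fun A hA => by rw [h A (mem_range.1 hA)]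

theorem ch_mul {k : ℕ} (hk : k < 11) (v v' : ℕ → F) :
    ch k (fun C => ∑ A ∈ range 16, ∑ B ∈ range 16, (nn A B C : F) * v A * v' B) =
      ch k v * ch k v' := by
  unfold ch
  rw [Finset.sum_mul_sum]
  simp only [Finset.mul_sum]
  rw [Finset.sum_comm]
  refine Finset.sum_congr rfl fun A hA => ?_
  rw [Finset.sum_comm]
  refine Finset.sum_congr rfl fun B hB => ?_
  have h := congrArg (fun z : ℤ => (z : F)) (Xmul k hk A (mem_range.1 hA) B (mem_range.1 hB))
  push_cast at h
  calc _ = (∑ C ∈ range 16, (nn A B C : F) * (ent Xt k C : F)) * (v A * v' B) := by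
        rw [Finset.sum_mul]
        exact Finset.sum_congr rfl fun C _ => by ring
    _ = _ := by rw [h]; ring

/-- The basis of the radical, on coordinate vectors. -/
def av (F : Type*) [Field F] (j : ℕ) : ℕ → F := fun A => (ent avt j A : F)

theorem ch_av {k : ℕ} (hk : k < 11) {j : ℕ} (hj : j < 5) : ch k (av F j) = 0 := by
  have h := congrArg (fun z : ℤ => (z : F)) (Xat k hk j hj)
  push_cast at h
  exact h

/-- The dual functionals. -/
noncomputable def bv (j : ℕ) (v : ℕ → F) : F := ∑ A ∈ range 16, (ent bt j A : F) * v A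

theorem bv_av {i : ℕ} (hi : i < 5) {j : ℕ} (hj : j < 5) :
    bv i (av F j) = if i = j then 1 else 0 := by
  have h := congrArg (fun z : ℤ => (z : F)) (bat i hi j hj)
  push_cast at h
  exact h

theorem expand (h192 : (192 : F) ≠ 0) (v : ℕ → F) (hv : ∀ k < 11, ch k v = 0) :
    ∀ B < 16, v B = ∑ j ∈ range 5, bv j v * av F j B := by
  intro B hB
  apply mul_left_cancel₀ h192
  have h1 : ∑ A ∈ range 16, (192 * ∑ j ∈ range 5, (ent bt j A : F) * (ent avt j B : F) +
      ∑ k ∈ range 11, (ent Xt k A : F) * (ent et k B : F)) * v A = 192 * v B := by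
    rw [Finset.sum_eq_single B]
    · have h := congrArg (fun z : ℤ => (z : F)) (resolve B hB B hB)
      push_cast at h
      rw [h, if_pos rfl]
    · intro A hA hAB
      have h := congrArg (fun z : ℤ => (z : F)) (resolve A (mem_range.1 hA) B hB)
      push_cast at h
      rw [h, if_neg hAB, zero_mul]
    · intro h; exact absurd (mem_range.2 hB) h
  rw [← h1]
  simp only [add_mul, Finset.sum_add_distrib]
  have h2 : ∑ A ∈ range 16, (∑ k ∈ range 11, (ent Xt k A : F) * (ent et k B : F)) * v A = 0 := by
    simp only [Finset.sum_mul]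
    rw [Finset.sum_comm]
    refine Finset.sum_eq_zero fun k hk => ?_
    have := hv k (mem_range.1 hk)
    unfold ch at this
    calc _ = (∑ A ∈ range 16, (ent Xt k A : F) * v A) * (ent et k B : F) := by
          rw [Finset.sum_mul]
          exact Finset.sum_congr rfl fun C _ => by ring
      _ = 0 := by rw [this, zero_mul]
  rw [h2, add_zero]
  simp only [mul_assoc, ← Finset.mul_sum]
  congr 1
  simp only [Finset.sum_mul, bv]
  rw [Finset.sum_comm]
  refine Finset.sum_congr rfl fun j _ => Finset.sum_congr rfl fun A _ => ?_
  simp only [av]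
  ring

theorem av_mul {i : ℕ} (hi : i < 5) {j : ℕ} (hj : j < 5) :
    th cs (av F i) * th cs (av F j) = 0 := by
  rw [th_mul, th_congr cs (v' := fun _ => 0)]
  · simp [th]
  · intro C hC
    have h := congrArg (fun z : ℤ => (z : F)) (at_at i hi j hj C hC)
    push_cast at h
    exact h

open Classical in
theorem descentElt_eq (J : Set (Fin 4)) : descentElt F cs J =
    th cs (fun A => if ∀ i ∈ J, A.testBit i = false then 1 else 0) := by
  unfold descentElt th
  refine Finset.sum_congr rfl fun w _ => ?_
  simp only [desc_iff]
  split_ifs <;> simp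

theorem mem_form {d : MonoidAlgebra F W} (hd : d ∈ descentAlgebra F cs) :
    ∃ v : ℕ → F, d = th cs v := by
  unfold descentAlgebra at hd
  induction hd using Algebra.adjoin_induction with
  | mem x hx =>
    obtain ⟨J, rfl⟩ := hx
    exact ⟨_, descentElt_eq cs J⟩
  | algebraMap r =>
    refine ⟨fun A => r * (if A = 0 then 1 else 0), ?_⟩
    rw [← th_smul, th_one, Algebra.algebraMap_eq_smul_one]
  | add x y _ _ hx hy =>
    obtain ⟨v, rfl⟩ := hx
    obtain ⟨v', rfl⟩ := hy
    exact ⟨_, th_add cs v v'⟩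
  | mul x y _ _ hx hy =>
    obtain ⟨v, rfl⟩ := hx
    obtain ⟨v', rfl⟩ := hy
    exact ⟨_, th_mul cs v v'⟩

theorem sub_eq_av {J K : Set (Fin 4)} {j : ℕ}
    (p q : ℕ → Bool) (hp : ∀ A, (∀ i ∈ J, A.testBit i = false) ↔ p A = true)
    (hq : ∀ A, (∀ i ∈ K, A.testBit i = false) ↔ q A = true)
    (h : ∀ A < 16, ent avt j A = (if p A = true then 1 else 0) - (if q A = true then 1 else 0)) :
    descentElt F cs J - descentElt F cs K = th cs (av F j) := by
  classical
  rw [descentElt_eq, descentElt_eq, th_sub]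
  apply th_congr
  intro A hA
  simp only [av, h A hA, hp, hq]
  push_cast
  rfl

end algebra

end D4

/-- If `char F ∉ {2, 3}`, the Jacobson radical of the descent algebra `D = D_F(D_4)`, viewed as
an `F`-subspace of the group algebra, is the span of the five linearly independent elements
`x_{{0}}−x_{{1}}`, `x_{{1}}−x_{{2}}`, `x_{{2}}−x_{{3}}`, `x_{{0,2}}−x_{{1,2}}`,
`x_{{1,2}}−x_{{2,3}}`; in particular it is 5-dimensional.  Moreover `J(D)² = 0`. -/
theorem stmt_15 (F : Type*) [Field F] (hchar2 : ringChar F ≠ 2) (hchar3 : ringChar F ≠ 3)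
    (W : Type*) [Group W] [Fintype W] (cs : CoxeterSystem (DMat 4) W)
    (D : Subalgebra F (MonoidAlgebra F W)) (hD : D = descentAlgebra F cs)
    (Jac : Ideal ↥D) (hJac : Jac = (⊥ : Ideal ↥D).jacobson)
    (a₁ a₂ a₃ a₄ a₅ : MonoidAlgebra F W)
    (ha₁ : a₁ = descentElt F cs ({0} : Set (Fin 4)) - descentElt F cs ({1} : Set (Fin 4)))
    (ha₂ : a₂ = descentElt F cs ({1} : Set (Fin 4)) - descentElt F cs ({2} : Set (Fin 4)))
    (ha₃ : a₃ = descentElt F cs ({2} : Set (Fin 4)) - descentElt F cs ({3} : Set (Fin 4)))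
    (ha₄ : a₄ = descentElt F cs ({0, 2} : Set (Fin 4)) - descentElt F cs ({1, 2} : Set (Fin 4)))
    (ha₅ : a₅ = descentElt F cs ({1, 2} : Set (Fin 4)) - descentElt F cs ({2, 3} : Set (Fin 4))) :
    Submodule.map D.val.toLinearMap (Jac.restrictScalars F) =
      Submodule.span F {a₁, a₂, a₃, a₄, a₅} ∧
    LinearIndependent F ![a₁, a₂, a₃, a₄, a₅] ∧
    Module.finrank F ↥(Jac.restrictScalars F) = 5 ∧
    ∀ x ∈ Jac, ∀ y ∈ Jac, x * y = 0 := by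
  have h192 : (192 : F) ≠ 0 := by
    have h2 : (2 : F) ≠ 0 := Ring.two_ne_zero hchar2
    have h3 : (3 : F) ≠ 0 := by
      intro h
      have hd : ringChar F ∣ 3 := (ringChar.spec F 3).1 (by exact_mod_cast h)
      rcases (Nat.dvd_prime Nat.prime_three).1 hd with h1 | h1
      · exact CharP.ringChar_ne_one h1
      · exact hchar3 h1
    have : (192 : F) = 2 ^ 6 * 3 := by norm_num
    rw [this]
    exact mul_ne_zero (pow_ne_zero _ h2) h3
  have e₁ : a₁ = D4.th cs (D4.av F 0) := by
    rw [ha₁]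
    exact D4.sub_eq_av cs (fun A => !A.testBit 0) (fun A => !A.testBit 1)
      (by simp) (by simp) (by decide +kernel)
  have e₂ : a₂ = D4.th cs (D4.av F 1) := by
    rw [ha₂]
    exact D4.sub_eq_av cs (fun A => !A.testBit 1) (fun A => !A.testBit 2)
      (by simp) (by simp) (by decide +kernel)
  have e₃ : a₃ = D4.th cs (D4.av F 2) := by
    rw [ha₃]
    exact D4.sub_eq_av cs (fun A => !A.testBit 2) (fun A => !A.testBit 3)
      (by simp) (by simp) (by decide +kernel)
  have e₄ : a₄ = D4.th cs (D4.av F 3) := by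
    rw [ha₄]
    exact D4.sub_eq_av cs (fun A => !A.testBit 0 && !A.testBit 2)
      (fun A => !A.testBit 1 && !A.testBit 2) (by simp) (by simp) (by decide +kernel)
  have e₅ : a₅ = D4.th cs (D4.av F 4) := by
    rw [ha₅]
    exact D4.sub_eq_av cs (fun A => !A.testBit 1 && !A.testBit 2)
      (fun A => !A.testBit 2 && !A.testBit 3) (by simp) (by simp) (by decide +kernel)
  have hx : ∀ J, descentElt F cs J ∈ D := fun J => by
    rw [hD]; exact Algebra.subset_adjoin ⟨J, rfl⟩
  have hform : ∀ d : D, ∃ v : ℕ → F, (d : MonoidAlgebra F W) = D4.th cs v := fun d =>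
    D4.mem_form cs (by rw [← hD]; exact d.2)
  set S := Submodule.span F ({a₁, a₂, a₃, a₄, a₅} : Set (MonoidAlgebra F W)) with hS
  have hrange : Set.range ![a₁, a₂, a₃, a₄, a₅] = {a₁, a₂, a₃, a₄, a₅} := by
    ext x
    simp only [Set.mem_range, Fin.exists_fin_succ, Set.mem_insert_iff, Set.mem_singleton_iff]
    simp [eq_comm]
  have hSD : S ≤ Subalgebra.toSubmodule D := by
    rw [hS, Submodule.span_le]
    rintro x (rfl | rfl | rfl | rfl | rfl)
    · rw [ha₁]; exact D.sub_mem (hx _) (hx _)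
    · rw [ha₂]; exact D.sub_mem (hx _) (hx _)
    · rw [ha₃]; exact D.sub_mem (hx _) (hx _)
    · rw [ha₄]; exact D.sub_mem (hx _) (hx _)
    · rw [ha₅]; exact D.sub_mem (hx _) (hx _)
  have hav : ∀ x ∈ ({a₁, a₂, a₃, a₄, a₅} : Set (MonoidAlgebra F W)),
      ∃ j < 5, x = D4.th cs (D4.av F j) := by
    rintro x (rfl | rfl | rfl | rfl | rfl)
    · exact ⟨0, by norm_num, e₁⟩
    · exact ⟨1, by norm_num, e₂⟩
    · exact ⟨2, by norm_num, e₃⟩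
    · exact ⟨3, by norm_num, e₄⟩
    · exact ⟨4, by norm_num, e₅⟩
  have hSmem : ∀ v : ℕ → F, D4.th cs v ∈ S ↔ ∀ k < 11, D4.ch k v = 0 := by
    intro v
    constructor
    · have : ∀ x ∈ S, ∀ v : ℕ → F, x = D4.th cs v → ∀ k < 11, D4.ch k v = 0 := by
        intro x hxS
        have h' : ∃ v : ℕ → F, x = D4.th cs v ∧ ∀ k < 11, D4.ch k v = 0 := by
          induction hxS using Submodule.span_induction with
          | mem x hx =>
            obtain ⟨j, hj, rfl⟩ := hav x hx
            exact ⟨_, rfl, fun k hk => D4.ch_av hk hj⟩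
          | zero => exact ⟨fun _ => 0, by simp [D4.th], by simp [D4.ch]⟩
          | add x y _ _ hx hy =>
            obtain ⟨v, rfl, hv⟩ := hx
            obtain ⟨w, rfl, hw⟩ := hy
            refine ⟨_, D4.th_add cs v w, fun k hk => ?_⟩
            have h1 := hv k hk
            have h2 := hw k hk
            simp only [D4.ch] at h1 h2 ⊢
            simp [mul_add, Finset.sum_add_distrib, h1, h2]
          | smul c x _ hx =>
            obtain ⟨v, rfl, hv⟩ := hx
            refine ⟨_, D4.th_smul cs c v, fun k hk => ?_⟩
            have h1 := hv k hk
            simp only [D4.ch] at h1 ⊢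
            simp only [mul_left_comm _ c, ← Finset.mul_sum, h1, mul_zero]
        obtain ⟨v', hv', hk'⟩ := h'
        intro v hv k hk
        rw [← hk' k hk]
        have := D4.th_inj cs (hv.symm.trans hv')
        exact Finset.sum_congr rfl fun A hA => by rw [this A (Finset.mem_range.1 hA)]
      exact fun h => this _ h v rfl
    · intro h
      have h1 := D4.expand h192 v h
      have h2 : D4.th cs v = D4.bv 0 v • a₁ + D4.bv 1 v • a₂ + D4.bv 2 v • a₃ +
          D4.bv 3 v • a₄ + D4.bv 4 v • a₅ := by
        rw [e₁, e₂, e₃, e₄, e₅]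
        simp only [D4.th_smul, D4.th_add]
        apply D4.th_congr
        intro A hA
        rw [h1 A hA]
        simp [Finset.sum_range_succ]
      rw [h2]
      have hm : ∀ x ∈ ({a₁, a₂, a₃, a₄, a₅} : Set (MonoidAlgebra F W)), ∀ c : F, c • x ∈ S :=
        fun x hx c => S.smul_mem c (Submodule.subset_span hx)
      exact S.add_mem (S.add_mem (S.add_mem (S.add_mem (hm _ (by simp) _) (hm _ (by simp) _))
        (hm _ (by simp) _)) (hm _ (by simp) _)) (hm _ (by simp) _)
  have hSS : ∀ x ∈ S, ∀ y ∈ S, x * y = 0 := by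
    intro x hx y hy
    induction hx, hy using Submodule.span_induction₂ with
    | mem_mem x y hx hy =>
      obtain ⟨i, hi, rfl⟩ := hav x hx
      obtain ⟨j, hj, rfl⟩ := hav y hy
      exact D4.av_mul cs hi hj
    | zero_left => simp
    | zero_right => simp
    | add_left _ _ _ _ _ _ h1 h2 => rw [add_mul, h1, h2, add_zero]
    | add_right _ _ _ _ _ _ h1 h2 => rw [mul_add, h1, h2, add_zero]
    | smul_left _ _ _ _ _ h => rw [smul_mul_assoc, h, smul_zero]
    | smul_right _ _ _ _ _ h => rw [mul_smul_comm, h, smul_zero]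
  have hJmem : ∀ d : D, d ∈ Jac ↔ (d : MonoidAlgebra F W) ∈ S := by
    intro d
    obtain ⟨v, hv⟩ := hform d
    rw [hJac, Ideal.mem_jacobson_iff]
    constructor
    · intro h
      rw [hv, hSmem]
      intro k hk
      by_contra hne
      obtain ⟨z, hz⟩ := h (algebraMap F D (-(D4.ch k v)⁻¹))
      rw [Ideal.mem_bot, sub_eq_zero] at hz
      obtain ⟨vz, hvz⟩ := hform z
      have hz' := congrArg (fun t : D => (t : MonoidAlgebra F W)) hz
      have hone : (1 : MonoidAlgebra F W) =
        D4.th cs (fun A => if A = 0 then (1 : F) else 0) := (D4.th_one cs).symm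
      have hch1 : D4.ch k (fun A => if A = 0 then (1 : F) else 0) = 1 := by
        have h0 : ∀ k < 11, D4.ent D4.Xt k 0 = 1 := by decide +kernel
        simp [D4.ch, h0 k hk]
      have hz2 : (-(D4.ch k v)⁻¹) • (D4.th cs vz * D4.th cs v) + D4.th cs vz = 1 := by
        rw [← hvz, ← hv]
        simpa [Algebra.algebraMap_eq_smul_one] using hz'
      rw [D4.th_mul, D4.th_smul, D4.th_add, hone] at hz2
      have hi := D4.th_inj cs hz2
      have hm := D4.ch_mul hk vz v
      have hfin : -(D4.ch k v)⁻¹ * (D4.ch k vz * D4.ch k v) + D4.ch k vz = 1 := by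
        rw [← hm, ← hch1, ← D4.ch_lin]
        exact D4.ch_congr k hi
      have : -(D4.ch k v)⁻¹ * (D4.ch k vz * D4.ch k v) + D4.ch k vz = 0 := by
        field_simp
        ring
      rw [this] at hfin
      exact zero_ne_one hfin
    · intro h y
      obtain ⟨vy, hvy⟩ := hform y
      have hyd : ((y * d : D) : MonoidAlgebra F W) ∈ S := by
        rw [hv, hSmem] at h
        rw [MulMemClass.coe_mul, hv, hvy, D4.th_mul, hSmem]
        intro k hk
        rw [D4.ch_mul hk, h k hk, mul_zero]
      have h0 : (y * d) * (y * d) = 0 := Subtype.ext (hSS _ hyd _ hyd)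
      refine ⟨1 - y * d, ?_⟩
      rw [Ideal.mem_bot]
      have : (1 - y * d) * y * d + (1 - y * d) - 1 = -((y * d) * (y * d)) := by
        simp only [sub_mul, one_mul, mul_assoc]
        abel
      rw [this, h0, neg_zero]
  have hmap : Submodule.map D.val.toLinearMap (Jac.restrictScalars F) = S := by
    ext x
    constructor
    · rintro ⟨d, hd, rfl⟩
      exact (hJmem d).1 hd
    · intro hxS
      exact ⟨⟨x, hSD hxS⟩, (hJmem _).2 hxS, rfl⟩
  have hli : LinearIndependent F ![a₁, a₂, a₃, a₄, a₅] := by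
    rw [Fintype.linearIndependent_iff]
    intro c hc
    have h1 : D4.th cs (fun A => c 0 * D4.av F 0 A + c 1 * D4.av F 1 A + c 2 * D4.av F 2 A +
        c 3 * D4.av F 3 A + c 4 * D4.av F 4 A) = D4.th cs (fun _ => 0) := by
      simp only [← D4.th_add, ← D4.th_smul, ← e₁, ← e₂, ← e₃, ← e₄, ← e₅]
      simpa [Fin.sum_univ_five, D4.th] using hc
    have h2 := D4.th_inj cs h1
    have h3 : ∀ i < 5, c 0 * D4.bv i (D4.av F 0) + c 1 * D4.bv i (D4.av F 1) +
        c 2 * D4.bv i (D4.av F 2) + c 3 * D4.bv i (D4.av F 3) +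
        c 4 * D4.bv i (D4.av F 4) = 0 := by
      intro i _
      simp only [D4.bv, Finset.mul_sum, ← Finset.sum_add_distrib]
      refine Finset.sum_eq_zero fun A hA => ?_
      have := h2 A (Finset.mem_range.1 hA)
      linear_combination (D4.ent D4.bt i A : F) * this
    intro i
    have h4 := h3 i i.2
    rw [D4.bv_av i.2 (by norm_num), D4.bv_av i.2 (by norm_num), D4.bv_av i.2 (by norm_num),
      D4.bv_av i.2 (by norm_num), D4.bv_av i.2 (by norm_num)] at h4
    fin_cases i <;> simpa using h4
  refine ⟨hmap, hli, ?_, ?_⟩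
  · have hinj : Function.Injective D.val.toLinearMap := Subtype.val_injective
    rw [(Submodule.equivMapOfInjective _ hinj (Jac.restrictScalars F)).finrank_eq, hmap]
    rw [hS, ← hrange, finrank_span_eq_card hli, Fintype.card_fin]
  · intro x hx y hy
    exact Subtype.ext (hSS _ ((hJmem x).1 hx) _ ((hJmem y).1 hy))
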